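/- For every integer n ≥ 0, ω_6(n,0) − ω_6(n,2) = (1/1440)·n³ + ((1/64)·cos(πn) + 7/960)·n² + ((7/64)·cos(πn) + 37/320)·n + (1/100)·√5·√(10+2√5)·sin(2πn/5) − (1/100)·√(10+2√5)·sin(2πn/5) − (1/50)·√5·cos(4πn/5) + (1/10)·cos(4πn/5) − (1/100)·√5·√(10−2√5)·sin(4πn/5) − (1/100)·√(10−2√5)·sin(4πn/5) + (1/9)·cos(2πn/3) + (1/27)·√3·sin(2πn/3) − (1/16)·sin(πn/2) + (1/16)·cos(πn/2) + (9/32)·cos(πn) + (1/10)·cos(2πn/5) + (1/50)·√5·cos(2πn/5) + 497/1440, where cos and sin are the real cosine and sine functions and √ denotes the real square root. -/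

import Mathlib

open Real

/-- `ω_d(n,k)`: the number of tuples `(α₀,…,α_d)` of non-negative integers with
`α₁ + 2α₂ + ⋯ + d·α_d = (dn−k)/2` and `α₀ + α₁ + ⋯ + α_d = n`; it is `0` when
`(dn−k)/2` is not a non-negative integer (here encoded by `2·Σ i·αᵢ + k = d·n`). -/
noncomputable def omega (d n k : ℕ) : ℕ :=
  {α : Fin (d + 1) → ℕ |
    2 * (∑ i : Fin (d + 1), (i : ℕ) * α i) + k = d * n ∧ ∑ i, α i = n}.ncard

open Polynomial in
noncomputable def gauss : ℕ → ℕ → ℤ[X]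
  | 0, _ => 1
  | k + 1, n => ∑ b ∈ Finset.range (n + 1), X ^ b * gauss k b

open Polynomial in
theorem gauss_eq_sum (k n : ℕ) : gauss k n =
    ∑ α ∈ Finset.Nat.antidiagonalTuple (k + 1) n, (X : ℤ[X]) ^ (∑ i : Fin (k + 1), (i : ℕ) * α i) := by
  induction k generalizing n with
  | zero => simp [gauss]
  | succ k ih =>
    have key : ∀ f : (Fin (k + 2) → ℕ) → ℤ[X], ∑ α ∈ Finset.Nat.antidiagonalTuple (k + 2) n, f α
        = ∑ p ∈ Finset.HasAntidiagonal.antidiagonal n, ∑ β ∈ Finset.Nat.antidiagonalTuple (k + 1) p.2,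
            f (Fin.cons p.1 β) := by
      intro f
      change ((List.Nat.antidiagonalTuple (k + 2) n).map f).sum =
        ((List.Nat.antidiagonal n).map (fun p =>
          ((List.Nat.antidiagonalTuple (k + 1) p.2).map (fun β => f (Fin.cons p.1 β))).sum)).sum
      rw [List.Nat.antidiagonalTuple, List.map_flatMap, List.flatMap, List.sum_flatten]
      simp only [List.map_map]
      rfl
    rw [key, ← Finset.Nat.sum_antidiagonal_swap, Finset.Nat.sum_antidiagonal_eq_sum_range_succ_mk, gauss]
    refine Finset.sum_congr rfl fun b _ => ?_
    rw [ih, Finset.mul_sum]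
    refine Finset.sum_congr rfl fun β hβ => ?_
    rw [Finset.Nat.mem_antidiagonalTuple] at hβ
    simp only [Prod.snd_swap, Prod.fst_swap] at hβ ⊢
    rw [← pow_add]
    congr 1
    rw [Fin.sum_univ_succ (n := k + 1)]
    simp only [Fin.cons_succ, Fin.val_succ, add_mul, Finset.sum_add_distrib, one_mul, hβ]
    simp [add_comm]

theorem omega_eq_coeff (d n k w : ℕ) (h : 2 * w + k = d * n) :
    (omega d n k : ℤ) = (gauss d n).coeff w := by
  have : {α : Fin (d + 1) → ℕ |
      2 * (∑ i : Fin (d + 1), (i : ℕ) * α i) + k = d * n ∧ ∑ i, α i = n} =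
      (((Finset.Nat.antidiagonalTuple (d + 1) n).filter
        (fun α => w = ∑ i : Fin (d + 1), (i : ℕ) * α i) : Finset (Fin (d + 1) → ℕ)) : Set _) := by
    ext α
    simp only [Set.mem_ofPred_eq, Finset.coe_filter, Finset.Nat.mem_antidiagonalTuple]
    omega
  rw [omega, this, Set.ncard_coe_finset, gauss_eq_sum, Polynomial.finsetSum_coeff]
  simp only [Polynomial.coeff_X_pow]
  simp

theorem omega_zero_two : omega 6 0 2 = 0 := by
  rw [omega]
  simp

open Polynomial in
theorem omega_sub (n : ℕ) :
    (omega 6 n 0 : ℤ) - (omega 6 n 2 : ℤ) = ((1 - X) * gauss 6 n).coeff (3 * n) := by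
  rw [omega_eq_coeff 6 n 0 (3 * n) (by ring), sub_mul, one_mul, coeff_sub]
  cases n with
  | zero => simp [omega_zero_two]
  | succ n =>
    rw [omega_eq_coeff 6 (n + 1) 2 (3 * n + 2) (by ring), show 3 * (n + 1) = 3 * n + 2 + 1 by ring,
      coeff_X_mul]

open Polynomial in
theorem gauss_mul (k n : ℕ) :
    (∏ i ∈ Finset.range k, (1 - (X : ℤ[X]) ^ (i + 1))) * gauss k n =
      ∏ i ∈ Finset.range k, (1 - X ^ (n + i + 1)) := by
  induction k generalizing n with
  | zero => simp [gauss]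
  | succ k ih =>
    rw [gauss]
    induction n with
    | zero =>
      rw [Finset.sum_range_one]
      have := ih 0
      rw [Finset.prod_range_succ, Finset.prod_range_succ, pow_zero, one_mul, mul_right_comm, this]
      simp
    | succ n ihn =>
      rw [Finset.sum_range_succ, mul_add, ihn, Finset.prod_range_succ (n := k) (f := fun i => 1 - (X : ℤ[X]) ^ (i + 1))]
      have e := ih (n + 1)
      have e2 : ∏ i ∈ Finset.range (k + 1), (1 - (X : ℤ[X]) ^ (n + i + 1)) =
          (1 - X ^ (n + 1)) * ∏ i ∈ Finset.range k, (1 - X ^ (n + 1 + i + 1)) := by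
        rw [Finset.prod_range_succ', mul_comm]
        congr 1
        exact Finset.prod_congr rfl fun i _ => by ring
      rw [e2, Finset.prod_range_succ]
      linear_combination (1 - (X : ℤ[X]) ^ (k + 1)) * X ^ (n + 1) * e

def rA {R : Type*} [CommRing R] (X : R) : R := ((1 + X ^ 2 + X ^ 4) * (1 + X ^ 3 + X ^ 6) * (1 + X ^ 4 + X ^ 8) * (1 + X ^ 5 + X ^ 10) * (1 + X ^ 6 + X ^ 12))

def rB {R : Type*} [CommRing R] (X : R) : R := ((X ^ 1 + X ^ 2 + X ^ 3 + X ^ 4 + X ^ 5 + X ^ 6) * ((1 + X ^ 2) * (1 + X ^ 3) * (1 + X ^ 4) * (1 + X ^ 5) * (1 + X ^ 6)))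

def rC {R : Type*} [CommRing R] (X : R) : R := (X ^ 3 + X ^ 4 + 2 * X ^ 5 + 2 * X ^ 6 + 3 * X ^ 7 + 2 * X ^ 8 + 2 * X ^ 9 + X ^ 10 + X ^ 11)

def rE {R : Type*} [CommRing R] (X Y : R) : R := (- ((X ^ 9 + X ^ 10 + 2 * X ^ 11 + 2 * X ^ 12 + 3 * X ^ 13 + 2 * X ^ 14 + 2 * X ^ 15 + X ^ 16 + X ^ 17)) + Y * (X ^ 14 + X ^ 15 + X ^ 16 + X ^ 17 + X ^ 18 + X ^ 19) * ((1 + X ^ 2) * (1 + X ^ 3) * (1 + X ^ 4) * (1 + X ^ 5) * (1 + X ^ 6)) - Y ^ 2 * X ^ 20 * ((1 + X ^ 2 + X ^ 4) * (1 + X ^ 3 + X ^ 6) * (1 + X ^ 4 + X ^ 8) * (1 + X ^ 5 + X ^ 10) * (1 + X ^ 6 + X ^ 12)))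

theorem key_identity {R : Type*} [CommRing R] (X Y : R) (h : ℕ → R)
    (hh : ∀ k, ((1 - X ^ 2) * (1 - X ^ 3) * (1 - X ^ 4) * (1 - X ^ 5) * (1 - X ^ 6)) * h k =
      1 - (X ^ 1 + X ^ 2 + X ^ 3 + X ^ 4 + X ^ 5 + X ^ 6) * (Y * X ^ k) ^ 1 + (X ^ 3 + X ^ 4 + 2 * X ^ 5 + 2 * X ^ 6 + 3 * X ^ 7 + 2 * X ^ 8 + 2 * X ^ 9 + X ^ 10 + X ^ 11) * (Y * X ^ k) ^ 2 - (X ^ 6 + X ^ 7 + 2 * X ^ 8 + 3 * X ^ 9 + 3 * X ^ 10 + 3 * X ^ 11 + 3 * X ^ 12 + 2 * X ^ 13 + X ^ 14 + X ^ 15) * (Y * X ^ k) ^ 3 + (X ^ 10 + X ^ 11 + 2 * X ^ 12 + 2 * X ^ 13 + 3 * X ^ 14 + 2 * X ^ 15 + 2 * X ^ 16 + X ^ 17 + X ^ 18) * (Y * X ^ k) ^ 4 - (X ^ 15 + X ^ 16 + X ^ 17 + X ^ 18 + X ^ 19 + X ^ 20) * (Y * X ^ k) ^ 5 + (X ^ 21)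 * (Y * X ^ k) ^ 6) :
    ((1 - X ^ 2) * (1 - X ^ 3) * (1 - X ^ 4) * (1 - X ^ 5) * (1 - X ^ 6)) * (h 20 - X ^ 6 * h 18 - X ^ 9 * h 17 - X ^ 12 * h 16 + 2 * X ^ 21 * h 13 + 2 * X ^ 24 * h 12 + X ^ 27 * h 11 - X ^ 33 * h 9 - 2 * X ^ 36 * h 8 - 2 * X ^ 39 * h 7 + X ^ 48 * h 4 + X ^ 51 * h 3 + X ^ 54 * h 2 - X ^ 60 * h 0) =
    ((1 - X ^ 2) * (1 - X ^ 3) * (1 - X ^ 4) * (1 - X ^ 5) * (1 - X ^ 6)) * (rA X - Y * X ^ 20 * rB X + Y ^ 2 * X ^ 40 * rC X + Y ^ 3 * (Y * X ^ 61 * rE X Y)) := by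
  simp only [rA, rB, rC, rE]
  linear_combination hh 20 - X ^ 6 * hh 18 - X ^ 9 * hh 17 - X ^ 12 * hh 16 + 2 * X ^ 21 * hh 13 + 2 * X ^ 24 * hh 12 + X ^ 27 * hh 11 - X ^ 33 * hh 9 - 2 * X ^ 36 * hh 8 - 2 * X ^ 39 * hh 7 + X ^ 48 * hh 4 + X ^ 51 * hh 3 + X ^ 54 * hh 2 - X ^ 60 * hh 0

open Polynomial in
noncomputable def hser (n : ℕ) : ℤ[X] := (1 - X) * gauss 6 n

open Polynomial in
theorem hser_mul (n : ℕ) : ((1 - (X : ℤ[X]) ^ 2) * (1 - X ^ 3) * (1 - X ^ 4) * (1 - X ^ 5) * (1 - X ^ 6)) * hser n =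
    1 - (X ^ 1 + X ^ 2 + X ^ 3 + X ^ 4 + X ^ 5 + X ^ 6) * (X ^ n) ^ 1 + (X ^ 3 + X ^ 4 + 2 * X ^ 5 + 2 * X ^ 6 + 3 * X ^ 7 + 2 * X ^ 8 + 2 * X ^ 9 + X ^ 10 + X ^ 11) * (X ^ n) ^ 2 - (X ^ 6 + X ^ 7 + 2 * X ^ 8 + 3 * X ^ 9 + 3 * X ^ 10 + 3 * X ^ 11 + 3 * X ^ 12 + 2 * X ^ 13 + X ^ 14 + X ^ 15) * (X ^ n) ^ 3 + (X ^ 10 + X ^ 11 + 2 * X ^ 12 + 2 * X ^ 13 + 3 * X ^ 14 + 2 * X ^ 15 + 2 * X ^ 16 + X ^ 17 + X ^ 18) * (X ^ n) ^ 4 - (X ^ 15 + X ^ 16 + X ^ 17 + X ^ 18 + X ^ 19 + X ^ 20) * (X ^ n) ^ 5 + (X ^ 21) * (X ^ n) ^ 6 := by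
  have := gauss_mul 6 n
  simp only [Finset.prod_range_succ, Finset.prod_range_zero, pow_add] at this
  rw [hser]
  linear_combination this

open Polynomial in
theorem hser_rec (m : ℕ) :
    hser (m + 20) - X ^ 6 * hser (m + 18) - X ^ 9 * hser (m + 17) - X ^ 12 * hser (m + 16) + 2 * X ^ 21 * hser (m + 13) + 2 * X ^ 24 * hser (m + 12) + X ^ 27 * hser (m + 11) - X ^ 33 * hser (m + 9) - 2 * X ^ 36 * hser (m + 8) - 2 * X ^ 39 * hser (m + 7) + X ^ 48 * hser (m + 4) + X ^ 51 * hser (m + 3) + X ^ 54 * hser (m + 2) - X ^ 60 * hser m =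
    rA X - (X ^ m) * X ^ 20 * rB X + (X ^ m) ^ 2 * X ^ 40 * rC X + (X ^ m) ^ 3 * ((X ^ m) * X ^ 61 * rE X (X ^ m)) := by
  have h1 := key_identity (X : ℤ[X]) (X ^ m) (fun k => hser (m + k)) (fun k => by
    rw [hser_mul, pow_add])
  have nz : ∀ i : ℕ, (1 - (X : ℤ[X]) ^ (i + 1)) ≠ 0 := by
    intro i hi
    have := congrArg (fun p => p.coeff 0) hi
    simp [coeff_X_pow] at this
  have hD : (1 - (X : ℤ[X]) ^ 2) * (1 - X ^ 3) * (1 - X ^ 4) * (1 - X ^ 5) * (1 - X ^ 6) ≠ 0 :=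
    mul_ne_zero (mul_ne_zero (mul_ne_zero (mul_ne_zero (nz 1) (nz 2)) (nz 3)) (nz 4)) (nz 5)
  exact mul_left_cancel₀ hD h1

open Polynomial in
theorem coeff_rhs (m : ℕ) (A B C E : ℤ[X]) (hA : A.natDegree ≤ 59) (hB : B.natDegree ≤ 39)
    (hC : C.natDegree ≤ 19) :
    (A - X ^ m * X ^ 20 * B + (X ^ m) ^ 2 * X ^ 40 * C + (X ^ m) ^ 3 * (X ^ m * X ^ 61 * E)).coeff
      (3 * (m + 20)) = 0 := by
  have e1 : X ^ m * X ^ 20 * B = X ^ (m + 20) * B := by ring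
  have e2 : (X ^ m) ^ 2 * X ^ 40 * C = X ^ (2 * m + 40) * C := by ring
  have e3 : (X ^ m) ^ 3 * (X ^ m * X ^ 61 * E) = X ^ (4 * m + 61) * E := by ring
  rw [e1, e2, e3, coeff_add, coeff_add, coeff_sub, coeff_X_pow_mul', coeff_X_pow_mul', coeff_X_pow_mul',
    coeff_eq_zero_of_natDegree_lt (p := A) (by lia)]
  rw [if_pos (by lia), if_pos (by lia), coeff_eq_zero_of_natDegree_lt (p := B) (by lia),
    coeff_eq_zero_of_natDegree_lt (p := C) (by lia)]
  rw [if_neg (by lia)]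
  simp

open Polynomial in
theorem hcoeff_rec (u : ℕ → ℤ) (hu : ∀ n, u n = (hser n).coeff (3 * n)) (m : ℕ) :
    u (m + 20) - u (m + 18) - u (m + 17) - u (m + 16) + 2 * u (m + 13) + 2 * u (m + 12) + u (m + 11) - u (m + 9) - 2 * u (m + 8) - 2 * u (m + 7) + u (m + 4) + u (m + 3) + u (m + 2) - u m = 0 := by
  have sh : ∀ j k : ℕ, j + k = 20 → (X ^ (3 * k) * hser (m + j)).coeff (3 * (m + 20)) = u (m + j) := by
    intro j k hjk
    rw [hu, coeff_X_pow_mul', if_pos (by lia)]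
    congr 1
    lia
  have h0 := congrArg (fun p => p.coeff (3 * (m + 20))) (hser_rec m)
  rw [coeff_rhs m _ _ _ _ (by unfold rA; compute_degree!) (by unfold rB; compute_degree!) (by unfold rC; compute_degree!)] at h0
  rw [← h0, hu (m + 20)]
  rw [← sh 18 2 rfl]
  rw [← sh 17 3 rfl]
  rw [← sh 16 4 rfl]
  rw [← sh 13 7 rfl]
  rw [← sh 12 8 rfl]
  rw [← sh 11 9 rfl]
  rw [← sh 9 11 rfl]
  rw [← sh 8 12 rfl]
  rw [← sh 7 13 rfl]
  rw [← sh 4 16 rfl]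
  rw [← sh 3 17 rfl]
  rw [← sh 2 18 rfl]
  have sh0 := sh 0 20 rfl
  rw [Nat.add_zero] at sh0
  rw [← sh0]
  simp only [coeff_add, coeff_sub, mul_assoc, coeff_ofNat_mul, Nat.reduceMul]

/-- one layer of the pruned counting recursion -/
def cstep (f : ℕ → ℕ → ℕ) (k : ℕ) : ℕ → ℕ → ℕ :=
  fun n => Nat.rec (fun w => bif Nat.beq w 0 then 1 else 0)
    (fun n r w => bif Nat.ble w ((k + 1) * (n + 1)) then
      r w + (bif Nat.ble (n + 1) w then f (n + 1) (w - (n + 1)) else 0) else 0) n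

def cfun : ℕ → ℕ → ℕ → ℕ
  | 0 => fun _ w => bif Nat.beq w 0 then 1 else 0
  | k + 1 => cstep (cfun k) k

theorem gauss_natDegree (k n : ℕ) : (gauss k n).natDegree ≤ k * n := by
  induction k generalizing n with
  | zero => simp [gauss]
  | succ k ih =>
    rw [gauss]
    refine Polynomial.natDegree_sum_le_of_forall_le _ _ fun b hb => ?_
    have hb' : b ≤ n := Nat.lt_succ_iff.mp (Finset.mem_range.mp hb)
    refine Polynomial.natDegree_mul_le.trans ?_
    rw [Polynomial.natDegree_X_pow]
    have := ih b
    nlinarith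

theorem cfun_eq (k n w : ℕ) : (gauss k n).coeff w = (cfun k n w : ℤ) := by
  induction k generalizing n w with
  | zero =>
    rw [gauss, Polynomial.coeff_one]
    cases w <;> rfl
  | succ k ih =>
    induction n with
    | zero =>
      have h0 : gauss k 0 = 1 := by
        clear ih
        induction k with
        | zero => rfl
        | succ k ih => rw [gauss]; simpa using ih
      have : gauss (k + 1) 0 = 1 := by rw [gauss]; simpa using h0
      rw [this, Polynomial.coeff_one]
      cases w <;> rfl
    | succ n ihn =>
      have e : cfun (k + 1) (n + 1) w = bif Nat.ble w ((k + 1) * (n + 1)) then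
        cfun (k + 1) n w + (bif Nat.ble (n + 1) w then cfun k (n + 1) (w - (n + 1)) else 0) else 0 := rfl
      rw [e]
      cases hb : Nat.ble w ((k + 1) * (n + 1)) with
      | false =>
        have hw : ¬ w ≤ (k + 1) * (n + 1) := fun h => by
          rw [Nat.ble_eq_true_of_le h] at hb; exact absurd hb (by decide)
        rw [Polynomial.coeff_eq_zero_of_natDegree_lt
          (lt_of_le_of_lt (gauss_natDegree _ _) (not_le.mp hw))]
        rfl
      | true =>
        have g : gauss (k + 1) (n + 1) = gauss (k + 1) n + Polynomial.X ^ (n + 1) * gauss k (n + 1) := by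
          rw [gauss, Finset.sum_range_succ, ← gauss]
        rw [g, Polynomial.coeff_add, ihn, Polynomial.coeff_X_pow_mul', cond_true, Nat.cast_add, ih]
        congr 1
        by_cases h : n + 1 ≤ w
        · rw [if_pos h, Nat.ble_eq_true_of_le h, cond_true]
        · rw [if_neg h]
          have : Nat.ble (n + 1) w = false := by
            cases hc : Nat.ble (n + 1) w with
            | false => rfl
            | true => exact absurd (Nat.le_of_ble_eq_true hc) h
          rw [this]; rfl

theorem hser_coeff (n : ℕ) : (hser (n + 1)).coeff (3 * (n + 1)) =
    (cfun 6 (n + 1) (3 * n + 3) : ℤ) - (cfun 6 (n + 1) (3 * n + 2) : ℤ) := by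
  rw [hser, sub_mul, one_mul, Polynomial.coeff_sub, show 3 * (n + 1) = 3 * n + 2 + 1 by ring,
    Polynomial.coeff_X_mul, cfun_eq, cfun_eq]

def initVals : List ℤ := [0, 1, 0, 2, 0, 3, 0, 4, 0, 6, 0, 8, 0, 10, 1, 13, 1, 16, 2]

theorem init_check : ∀ n : Fin 19,
    (cfun 6 (n + 1) (3 * n + 3) : ℤ) - (cfun 6 (n + 1) (3 * n + 2) : ℤ) = initVals.getD n 0 := by
  decide +kernel

theorem hser_coeff_zero : (hser 0).coeff (3 * 0) = 1 := by
  rw [hser, sub_mul, one_mul, Polynomial.coeff_sub, cfun_eq]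
  simp [cfun, cstep]

noncomputable def tFive (n : ℕ) : ℝ := if n % 5 = 0 then 1 / 5 else if n % 5 = 3 then -1 / 5 else 0

noncomputable def tThree (n : ℕ) : ℝ := if n % 3 = 0 then 1 / 9 else if n % 3 = 2 then -1 / 9 else 0

noncomputable def tFour (n : ℕ) : ℝ := if n % 4 = 0 ∨ n % 4 = 3 then 1 / 16 else -1 / 16

noncomputable def fval (n : ℕ) : ℝ :=
  (1 / 1440) * n ^ 3 + ((1 / 64) * (-1) ^ n + 7 / 960) * n ^ 2 + ((7 / 64) * (-1) ^ n + 37 / 320) * n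
    + (9 / 32) * (-1) ^ n + 497 / 1440 + tFive n + tThree n + tFour n

theorem fval_rec (m : ℕ) :
    fval (m + 20) - fval (m + 18) - fval (m + 17) - fval (m + 16) + 2 * fval (m + 13) + 2 * fval (m + 12) + fval (m + 11) - fval (m + 9) - 2 * fval (m + 8) - 2 * fval (m + 7) + fval (m + 4) + fval (m + 3) + fval (m + 2) - fval m = 0 := by
  have h5 : ∀ k, tFive (k + 5) = tFive k := fun k => by simp [tFive]
  have h3 : ∀ k, tThree (k + 3) = tThree k := fun k => by simp [tThree]
  have h4 : ∀ k, tFour (k + 4) = tFour k := fun k => by simp [tFour]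
  have e5 : tFive (m + 20) - tFive (m + 18) - tFive (m + 17) - tFive (m + 16) + 2 * tFive (m + 13) + 2 * tFive (m + 12) + tFive (m + 11) - tFive (m + 9) - 2 * tFive (m + 8) - 2 * tFive (m + 7) + tFive (m + 4) + tFive (m + 3) + tFive (m + 2) - tFive m = 0 := by
    linear_combination (1) * h5 (m + 15) + (-1) * h5 (m + 13) + (-1) * h5 (m + 12) + (-1) * h5 (m + 11) + (1) * h5 (m + 10) + (1) * h5 (m + 8) + (1) * h5 (m + 7) + (1) * h5 (m + 5) + (-1) * h5 (m + 4) + (-1) * h5 (m + 3) + (-1) * h5 (m + 2) + (1) * h5 m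
  have e3 : tThree (m + 20) - tThree (m + 18) - tThree (m + 17) - tThree (m + 16) + 2 * tThree (m + 13) + 2 * tThree (m + 12) + tThree (m + 11) - tThree (m + 9) - 2 * tThree (m + 8) - 2 * tThree (m + 7) + tThree (m + 4) + tThree (m + 3) + tThree (m + 2) - tThree m = 0 := by
    linear_combination (1) * h3 (m + 17) + (-1) * h3 (m + 15) + (-1) * h3 (m + 13) + (-1) * h3 (m + 12) + (1) * h3 (m + 10) + (1) * h3 (m + 9) + (1) * h3 (m + 8) + (1) * h3 (m + 7) + (-1) * h3 (m + 5) + (-1) * h3 (m + 4) + (-1) * h3 (m + 2) + (1) * h3 m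
  have e4 : tFour (m + 20) - tFour (m + 18) - tFour (m + 17) - tFour (m + 16) + 2 * tFour (m + 13) + 2 * tFour (m + 12) + tFour (m + 11) - tFour (m + 9) - 2 * tFour (m + 8) - 2 * tFour (m + 7) + tFour (m + 4) + tFour (m + 3) + tFour (m + 2) - tFour m = 0 := by
    linear_combination (1) * h4 (m + 16) + (-1) * h4 (m + 14) + (-1) * h4 (m + 13) + (-1) * h4 (m + 10) + (1) * h4 (m + 9) + (2) * h4 (m + 8) + (1) * h4 (m + 7) + (-1) * h4 (m + 6) + (-1) * h4 (m + 3) + (-1) * h4 (m + 2) + (1) * h4 m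
  simp only [fval]
  push_cast
  simp only [pow_add]
  linear_combination e5 + e3 + e4

theorem fval_init : ∀ n : Fin 19, fval (n + 1) = (initVals.getD n 0 : ℤ) := by
  intro n
  fin_cases n <;> norm_num [fval, tFive, tThree, tFour, initVals]

theorem fval_zero : fval 0 = 1 := by
  norm_num [fval, tFive, tThree, tFour]

theorem hser_eq_fval (n : ℕ) : (((hser n).coeff (3 * n) : ℤ) : ℝ) = fval n := by
  induction n using Nat.strong_induction_on with
  | _ n ih =>
    by_cases h20 : 20 ≤ n
    · obtain ⟨m, rfl⟩ := Nat.exists_eq_add_of_le' h20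
      have h1 := hcoeff_rec (fun n => (hser n).coeff (3 * n)) (fun _ => rfl) m
      have h2 := fval_rec m
      have h1' := congrArg (Int.cast : ℤ → ℝ) h1
      push_cast at h1'
      rw [ih m (by lia), ih (m + 18) (by lia), ih (m + 17) (by lia), ih (m + 16) (by lia), ih (m + 13) (by lia), ih (m + 12) (by lia), ih (m + 11) (by lia), ih (m + 9) (by lia), ih (m + 8) (by lia), ih (m + 7) (by lia), ih (m + 4) (by lia), ih (m + 3) (by lia), ih (m + 2) (by lia)] at h1'
      linear_combination h1' - h2
    · rcases n with _ | n
      · rw [hser_coeff_zero, fval_zero]; simp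
      · rw [hser_coeff, init_check ⟨n, by lia⟩, ← fval_init ⟨n, by lia⟩]

theorem tThree_eq (n : ℕ) : (1 / 9) * Real.cos (2 * π * n / 3)
        + (1 / 27) * Real.sqrt 3 * Real.sin (2 * π * n / 3) = tThree n := by
  have hs : Real.sqrt 3 * Real.sqrt 3 = 3 := Real.mul_self_sqrt (by norm_num)
  have hc1 : Real.cos (2 * π / 3) = -1 / 2 := by
    rw [show 2 * π / 3 = π - π / 3 by ring, Real.cos_pi_sub, Real.cos_pi_div_three]; ring
  have hs1 : Real.sin (2 * π / 3) = Real.sqrt 3 / 2 := by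
    rw [show 2 * π / 3 = π - π / 3 by ring, Real.sin_pi_sub, Real.sin_pi_div_three]
  obtain ⟨q, r, hr, rfl⟩ : ∃ q r, r < 3 ∧ n = 3 * q + r := ⟨n / 3, n % 3, by lia, by lia⟩
  have ha : 2 * π * ((3 * q + r : ℕ) : ℝ) / 3 = 2 * π * r / 3 + q * (2 * π) := by push_cast; ring
  rw [ha, Real.cos_add_nat_mul_two_pi, Real.sin_add_nat_mul_two_pi]
  interval_cases r
  · simp [tThree]
  · rw [show 2 * π * ((1 : ℕ) : ℝ) / 3 = 2 * π / 3 by push_cast; ring, hc1, hs1]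
    simp [tThree, Nat.mul_add_mod]
    linear_combination (1 / 54) * hs
  · rw [show 2 * π * ((2 : ℕ) : ℝ) / 3 = 2 * (2 * π / 3) by push_cast; ring, Real.cos_two_mul,
      Real.sin_two_mul, hc1, hs1]
    simp [tThree, Nat.mul_add_mod]
    linear_combination (-1 / 54) * hs

theorem tFour_eq (n : ℕ) : (1 / 16) * Real.cos (π * n / 2) - (1 / 16) * Real.sin (π * n / 2) =
    tFour n := by
  obtain ⟨q, r, hr, rfl⟩ : ∃ q r, r < 4 ∧ n = 4 * q + r := ⟨n / 4, n % 4, by lia, by lia⟩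
  have ha : π * ((4 * q + r : ℕ) : ℝ) / 2 = π * r / 2 + q * (2 * π) := by push_cast; ring
  rw [ha, Real.cos_add_nat_mul_two_pi, Real.sin_add_nat_mul_two_pi]
  interval_cases r
  · simp [tFour]
  · rw [show π * ((1 : ℕ) : ℝ) / 2 = π / 2 by push_cast; ring, Real.cos_pi_div_two, Real.sin_pi_div_two]
    norm_num [tFour, Nat.mul_add_mod]
  · rw [show π * ((2 : ℕ) : ℝ) / 2 = π by push_cast; ring, Real.cos_pi, Real.sin_pi]
    norm_num [tFour, Nat.mul_add_mod]
  · rw [show π * ((3 : ℕ) : ℝ) / 2 = π / 2 + π by push_cast; ring, Real.cos_add_pi, Real.sin_add_pi,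
      Real.cos_pi_div_two, Real.sin_pi_div_two]
    norm_num [tFour, Nat.mul_add_mod]

theorem tFive_eq (n : ℕ) : (1 / 100) * Real.sqrt 5 * Real.sqrt (10 + 2 * Real.sqrt 5) * Real.sin (2 * π * n / 5)
        - (1 / 100) * Real.sqrt (10 + 2 * Real.sqrt 5) * Real.sin (2 * π * n / 5)
        - (1 / 50) * Real.sqrt 5 * Real.cos (4 * π * n / 5)
        + (1 / 10) * Real.cos (4 * π * n / 5)
        - (1 / 100) * Real.sqrt 5 * Real.sqrt (10 - 2 * Real.sqrt 5) * Real.sin (4 * π * n / 5)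
        - (1 / 100) * Real.sqrt (10 - 2 * Real.sqrt 5) * Real.sin (4 * π * n / 5)
        + (1 / 10) * Real.cos (2 * π * n / 5)
        + (1 / 50) * Real.sqrt 5 * Real.cos (2 * π * n / 5) = tFive n := by
  have hs : Real.sqrt 5 * Real.sqrt 5 = 5 := Real.mul_self_sqrt (by norm_num)
  have hs0 : 0 ≤ Real.sqrt 5 := Real.sqrt_nonneg 5
  have hs3 : Real.sqrt 5 ≤ 3 := by nlinarith
  have hc : Real.cos (π / 5) = (1 + Real.sqrt 5) / 4 := Real.cos_pi_div_five
  have hsp : 0 ≤ Real.sin (π / 5) :=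
    Real.sin_nonneg_of_nonneg_of_le_pi (by positivity) (by linarith [Real.pi_pos])
  have hsc := Real.sin_sq_add_cos_sq (π / 5)
  rw [hc] at hsc
  have hb : Real.sqrt (10 - 2 * Real.sqrt 5) = 4 * Real.sin (π / 5) := by
    rw [Real.sqrt_eq_iff_mul_self_eq (by linarith) (by positivity)]
    linear_combination hs - 16 * hsc
  have ha : Real.sqrt (10 + 2 * Real.sqrt 5) = 2 * (1 + Real.sqrt 5) * Real.sin (π / 5) := by
    rw [Real.sqrt_eq_iff_mul_self_eq (by linarith) (by positivity)]
    linear_combination -4 * (1 + Real.sqrt 5) ^ 2 * hsc + (1 / 4) * (Real.sqrt 5 * Real.sqrt 5 + 4 * Real.sqrt 5 - 5) * hs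
  rw [ha, hb]
  generalize Real.sqrt 5 = s at *
  have c1 : Real.cos (2 * π / 5) = (s - 1) / 4 := by
    rw [show 2 * π / 5 = 2 * (π / 5) by ring, Real.cos_two_mul, hc]
    linear_combination (1 / 8) * hs
  have s1 : Real.sin (2 * π / 5) = (1 + s) / 2 * Real.sin (π / 5) := by
    rw [show 2 * π / 5 = 2 * (π / 5) by ring, Real.sin_two_mul, hc]; ring
  have c2 : Real.cos (4 * π / 5) = -(1 + s) / 4 := by
    rw [show 4 * π / 5 = π - π / 5 by ring, Real.cos_pi_sub, hc]; ring
  have s2 : Real.sin (4 * π / 5) = Real.sin (π / 5) := by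
    rw [show 4 * π / 5 = π - π / 5 by ring, Real.sin_pi_sub]
  generalize Real.sin (π / 5) = t at *
  have ht : t ^ 2 = (10 - 2 * s) / 16 := by linear_combination hsc - (1 / 16) * hs
  have hs' : s ^ 2 = 5 := by linear_combination hs
  obtain ⟨q, r, hr, rfl⟩ : ∃ q r, r < 5 ∧ n = 5 * q + r := ⟨n / 5, n % 5, by lia, by lia⟩
  have h2 : 2 * π * ((5 * q + r : ℕ) : ℝ) / 5 = 2 * π * r / 5 + q * (2 * π) := by push_cast; ring
  have h4 : 4 * π * ((5 * q + r : ℕ) : ℝ) / 5 = 4 * π * r / 5 + (2 * q : ℕ) * (2 * π) := by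
    push_cast; ring
  rw [h2, h4, Real.cos_add_nat_mul_two_pi, Real.sin_add_nat_mul_two_pi,
    Real.cos_add_nat_mul_two_pi, Real.sin_add_nat_mul_two_pi]
  interval_cases r
  · simp [tFive]; ring
  · rw [show 2 * π * ((1 : ℕ) : ℝ) / 5 = 2 * π / 5 by push_cast; ring,
      show 4 * π * ((1 : ℕ) : ℝ) / 5 = 4 * π / 5 by push_cast; ring, c1, s1, c2, s2]
    norm_num [tFive, Nat.mul_add_mod]
    grind
  · rw [show 2 * π * ((2 : ℕ) : ℝ) / 5 = 4 * π / 5 by push_cast; ring,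
      show 4 * π * ((2 : ℕ) : ℝ) / 5 = 2 * π - 2 * π / 5 by push_cast; ring,
      Real.cos_two_pi_sub, Real.sin_two_pi_sub, c1, s1, c2, s2]
    norm_num [tFive, Nat.mul_add_mod]
    grind
  · rw [show 2 * π * ((3 : ℕ) : ℝ) / 5 = 2 * π - 4 * π / 5 by push_cast; ring,
      show 4 * π * ((3 : ℕ) : ℝ) / 5 = 2 * π / 5 + 2 * π by push_cast; ring,
      Real.cos_two_pi_sub, Real.sin_two_pi_sub, Real.cos_add_two_pi, Real.sin_add_two_pi, c1, s1, c2, s2]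
    norm_num [tFive, Nat.mul_add_mod]
    grind
  · rw [show 2 * π * ((4 : ℕ) : ℝ) / 5 = 2 * π - 2 * π / 5 by push_cast; ring,
      show 4 * π * ((4 : ℕ) : ℝ) / 5 = 2 * π - 4 * π / 5 + 2 * π by push_cast; ring,
      Real.cos_add_two_pi, Real.sin_add_two_pi, Real.cos_two_pi_sub, Real.sin_two_pi_sub,
      Real.cos_two_pi_sub, Real.sin_two_pi_sub, c1, s1, c2, s2]
    norm_num [tFive, Nat.mul_add_mod]
    grind

/-- The Hilbert polynomial of the algebra of invariants of the binary form of degree 6. -/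
theorem hilbert_polynomial_binary_form_deg_six (n : ℕ) :
    (omega 6 n 0 : ℝ) - (omega 6 n 2 : ℝ) =
      (1 / 1440) * n ^ 3
        + ((1 / 64) * Real.cos (π * n) + 7 / 960) * n ^ 2
        + ((7 / 64) * Real.cos (π * n) + 37 / 320) * n
        + (1 / 100) * Real.sqrt 5 * Real.sqrt (10 + 2 * Real.sqrt 5) * Real.sin (2 * π * n / 5)
        - (1 / 100) * Real.sqrt (10 + 2 * Real.sqrt 5) * Real.sin (2 * π * n / 5)
        - (1 / 50) * Real.sqrt 5 * Real.cos (4 * π * n / 5)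
        + (1 / 10) * Real.cos (4 * π * n / 5)
        - (1 / 100) * Real.sqrt 5 * Real.sqrt (10 - 2 * Real.sqrt 5) * Real.sin (4 * π * n / 5)
        - (1 / 100) * Real.sqrt (10 - 2 * Real.sqrt 5) * Real.sin (4 * π * n / 5)
        + (1 / 9) * Real.cos (2 * π * n / 3)
        + (1 / 27) * Real.sqrt 3 * Real.sin (2 * π * n / 3)
        - (1 / 16) * Real.sin (π * n / 2)
        + (1 / 16) * Real.cos (π * n / 2)
        + (9 / 32) * Real.cos (π * n)
        + (1 / 10) * Real.cos (2 * π * n / 5)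
        + (1 / 50) * Real.sqrt 5 * Real.cos (2 * π * n / 5)
        + 497 / 1440 := by
  have h1 : (omega 6 n 0 : ℝ) - (omega 6 n 2 : ℝ) = fval n := by
    rw [← hser_eq_fval, hser, ← omega_sub]
    push_cast
    rfl
  have hc : Real.cos (π * n) = (-1) ^ n := by rw [mul_comm, Real.cos_nat_mul_pi]
  rw [h1, fval, hc, ← tFive_eq, ← tThree_eq, ← tFour_eq]
  ring
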